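/- Let (Ω,F,P) be a probability space, 1 ≤ p < q < ∞, and fix portfolio weights (λ_n) ⊂ (0,∞) with λ̄_n := (1/n)∑_{i=1}^n λ_i. Let (X_n) ⊂ L^p(Ω) satisfy sup_n E[|X_n|^q] < ∞, E[X_n] = E[X₁] > 0 for all n, and suppose (1/(n λ̄_n)) ∑_{i=1}^n λ_i (X_i − E[X₁]) converges to 0 in probability. Let R : L^p(Ω) → ℝ be a coherent risk measure and Z ∈ L^p(Ω). Define the worst-case aggregate risk R_n^{WC}(Z) := sup { R(∑_{i=1}^n λ_i Y_i) : Y₁,…,Y_n ∈ L^p(Ω), each Y_i identically distributed as Z }. Then sup { R(Y) : Y ∈ L^p(Ω), Y identically distributed as Z } is finite, and R_n^{WC}(Z) / R( ∑_{i=1}^n λ_i X_i ) → sup { R(Y) : Y ∼ Z } / E[X₁] as n → ∞. -/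

import Mathlib

open MeasureTheory Filter Topology

/-- A finite monotone positively homogeneous functional on a Banach lattice is bounded above by a
multiple of the norm. -/
theorem exists_le_mul_norm_of_monotone {E : Type*} [NormedAddCommGroup E] [Lattice E]
    [HasSolidNorm E] [IsOrderedAddMonoid E] [NormedSpace ℝ E] [CompleteSpace E]
    {ρ : E → ℝ} (hmono : Monotone ρ) (hhom : ∀ x, ∀ c : ℝ, 0 < c → ρ (c • x) = c * ρ x) :
    ∃ C : ℝ, ∀ x, ρ x ≤ C * ‖x‖ := by
  by_contra! h
  choose y hy using fun k : ℕ => h (4 ^ k)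
  have h0 : ρ 0 = 0 := by
    have := hhom 0 2 two_pos
    rw [smul_zero] at this
    linarith
  have hpos : ∀ k, 0 < ‖y k‖ := fun k => by
    refine norm_pos_iff.2 fun hk => ?_
    have := hy k
    simp [hk, h0] at this
  set w : ℕ → E := fun k => |((2 : ℝ) ^ k * ‖y k‖)⁻¹ • y k| with hw
  have hwnorm : ∀ k, ‖w k‖ = (1 / 2 : ℝ) ^ k := fun k => by
    have := hpos k
    rw [hw]
    simp only [norm_abs_eq_norm, norm_smul, norm_inv, norm_mul, norm_pow, norm_norm]
    simp only [Real.norm_ofNat]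
    field_simp
    rw [one_div, inv_pow]
    field_simp
  have hsum : Summable w := by
    refine Summable.of_norm ?_
    simp_rw [hwnorm]
    exact summable_geometric_two
  have hle : ∀ k : ℕ, (2 : ℝ) ^ k ≤ ρ (∑' j, w j) := fun k => by
    have h1 : w k ≤ ∑' j, w j := hsum.le_tsum k fun j _ => abs_nonneg _
    have hc : 0 < ((2 : ℝ) ^ k * ‖y k‖)⁻¹ := by have := hpos k; positivity
    have h2 : ((2 : ℝ) ^ k * ‖y k‖)⁻¹ * ρ (y k) ≤ ρ (w k) := by
      rw [← hhom _ _ hc]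
      exact hmono (le_abs_self _)
    refine le_trans ?_ (h2.trans (hmono h1))
    have h3 : (2 : ℝ) ^ k = ((2 : ℝ) ^ k * ‖y k‖)⁻¹ * (4 ^ k * ‖y k‖) := by
      have := hpos k
      rw [show (4 : ℝ) = 2 * 2 by norm_num, mul_pow]
      field_simp
    calc (2 : ℝ) ^ k = ((2 : ℝ) ^ k * ‖y k‖)⁻¹ * (4 ^ k * ‖y k‖) := h3
      _ ≤ _ := by gcongr; exact (hy k).le
  obtain ⟨k, hk⟩ := pow_unbounded_of_one_lt (ρ (∑' j, w j)) (one_lt_two : (1 : ℝ) < 2)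
  exact absurd (hle k) (not_le.2 hk)

/-- A finite monotone positively homogeneous functional on `L^p` random variables is bounded above
by a multiple of the `L^p` norm. -/
theorem exists_le_mul_eLpNorm_of_monotone {Ω : Type*} [MeasurableSpace Ω] {P : Measure Ω}
    {p : ENNReal} [Fact (1 ≤ p)] {R : (Ω → ℝ) → ℝ}
    (hmono : ∀ X Y : Ω → ℝ, MemLp X p P → MemLp Y p P → (∀ᵐ ω ∂P, X ω ≤ Y ω) → R X ≤ R Y)
    (hposhom : ∀ X : Ω → ℝ, MemLp X p P → ∀ c : ℝ, 0 < c → R (fun ω => c * X ω) = c * R X) :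
    ∃ C : ℝ, ∀ X : Ω → ℝ, MemLp X p P → R X ≤ C * (eLpNorm X p P).toReal := by
  have hcongr : ∀ X Y : Ω → ℝ, MemLp X p P → MemLp Y p P → X =ᵐ[P] Y → R X = R Y :=
    fun X Y hX hY h => le_antisymm (hmono X Y hX hY h.le) (hmono Y X hY hX h.symm.le)
  obtain ⟨C, hC⟩ := exists_le_mul_norm_of_monotone (E := Lp ℝ p P) (ρ := fun f => R f)
    (fun f g hfg => hmono f g (Lp.memLp f) (Lp.memLp g) ((Lp.coeFn_le f g).2 hfg))
    (fun f c hc => by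
      rw [← hposhom f (Lp.memLp f) c hc]
      exact hcongr _ _ (Lp.memLp _) ((Lp.memLp f).const_mul c) (Lp.coeFn_smul c f))
  refine ⟨C, fun X hX => ?_⟩
  have := hC hX.toLp
  rwa [Lp.norm_toLp, hcongr _ X (Lp.memLp _) hX hX.coeFn_toLp] at this

/-- A form of the `L^p` tail estimate: the `L^p` norm is controlled by a truncation level and the
`L^q` norm times a power of the probability of exceeding that level. -/
theorem eLpNorm_le_add_mul_measure_rpow {Ω : Type*} [MeasurableSpace Ω] {P : Measure Ω}
    [IsProbabilityMeasure P] {p q : ENNReal} (hp : 1 ≤ p) (hpq : p ≤ q) {f : Ω → ℝ}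
    (hf : AEStronglyMeasurable f P) {ε : ℝ} (hε : 0 ≤ ε) :
    eLpNorm f p P ≤ ENNReal.ofReal ε +
      eLpNorm f q P * P {ω | ε < |f ω|} ^ (1 / p.toReal - 1 / q.toReal) := by
  set T := toMeasurable P {ω | ε < |f ω|} with hT
  have hTm : MeasurableSet T := measurableSet_toMeasurable _ _
  have h1 : eLpNorm f p P ≤ eLpNorm ((fun _ => ε) + T.indicator fun ω => |f ω|) p P := by
    refine eLpNorm_mono_real fun ω => ?_
    by_cases h : ω ∈ T
    · simp [h, hε]
    · have : |f ω| ≤ ε := not_lt.1 fun h' => h (subset_toMeasurable _ _ h')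
      simpa [h] using this
  refine h1.trans ((eLpNorm_add_le aestronglyMeasurable_const (hf.norm.indicator hTm) hp).trans ?_)
  refine add_le_add ?_ ?_
  · refine (eLpNorm_le_of_ae_bound (C := ε) ?_).trans (by simp)
    exact Eventually.of_forall fun ω => by simp [abs_of_nonneg hε]
  · rw [eLpNorm_indicator_eq_eLpNorm_restrict hTm]
    have h2 := eLpNorm_le_eLpNorm_mul_rpow_measure_univ (μ := P.restrict T) hpq hf.norm.restrict
    rw [Measure.restrict_apply_univ, hT, measure_toMeasurable] at h2
    refine h2.trans ?_
    gcongr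
    exact (eLpNorm_norm f).le.trans (eLpNorm_mono_measure _ Measure.restrict_le_self)

/-- A sequence bounded in `L^q` and converging to `0` in probability converges to `0` in `L^p`
for `p < q`. -/
theorem tendsto_eLpNorm_zero_of_eLpNorm_le {Ω : Type*} [MeasurableSpace Ω] {P : Measure Ω}
    [IsProbabilityMeasure P] {p q : ℝ} (hp : 1 ≤ p) (hpq : p < q) {f : ℕ → Ω → ℝ}
    (hf : ∀ n, AEStronglyMeasurable (f n) P) {K : ENNReal} (hK : K ≠ ⊤)
    (hfK : ∀ n, eLpNorm (f n) (ENNReal.ofReal q) P ≤ K)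
    (hprob : ∀ ε > (0 : ℝ), Tendsto (fun n => P {ω | ε < |f n ω|}) atTop (𝓝 0)) :
    Tendsto (fun n => eLpNorm (f n) (ENNReal.ofReal p) P) atTop (𝓝 0) := by
  have hr : 0 < 1 / p - 1 / q := by
    have := one_div_lt_one_div_of_lt (by linarith) hpq
    linarith
  have hbound : ∀ ε : ℝ, 0 ≤ ε → ∀ n, eLpNorm (f n) (ENNReal.ofReal p) P ≤
      ENNReal.ofReal ε + K * P {ω | ε < |f n ω|} ^ (1 / p - 1 / q) := fun ε hε n => by
    have h := eLpNorm_le_add_mul_measure_rpow (p := ENNReal.ofReal p) (q := ENNReal.ofReal q)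
      (by simpa using hp) (ENNReal.ofReal_le_ofReal hpq.le) (hf n) hε
    rw [ENNReal.toReal_ofReal (by linarith), ENNReal.toReal_ofReal (by linarith)] at h
    refine h.trans ?_
    gcongr
    exact hfK n
  rw [ENNReal.tendsto_nhds_zero]
  intro δ hδ
  obtain ⟨ε, hε, hεδ⟩ : ∃ ε : ℝ, 0 < ε ∧ ENNReal.ofReal ε < δ := by
    obtain ⟨e, he, heδ⟩ := ENNReal.lt_iff_exists_nnreal_btwn.1 hδ
    exact ⟨e, by simpa using he, by simpa using heδ⟩
  have hlim : Tendsto (fun n => ENNReal.ofReal ε + K * P {ω | ε < |f n ω|} ^ (1 / p - 1 / q))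
      atTop (𝓝 (ENNReal.ofReal ε)) := by
    have h1 := ((ENNReal.continuous_rpow_const (y := 1 / p - 1 / q)).tendsto 0).comp (hprob ε hε)
    rw [ENNReal.zero_rpow_of_pos hr] at h1
    have h2 := (ENNReal.Tendsto.const_mul h1 (Or.inr hK)).const_add (ENNReal.ofReal ε)
    simpa using h2
  filter_upwards [hlim.eventually_lt_const hεδ] with n hn
  exact (hbound ε hε.le n).trans hn.le

/-- A weighted average of random variables of `L^q` norm at most `K` has `L^q` norm at
most `K`. -/
theorem eLpNorm_weighted_average_le {Ω : Type*} [MeasurableSpace Ω] {P : Measure Ω}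
    {q : ENNReal} (hq : 1 ≤ q) {lam : ℕ → ℝ} (hlam : ∀ n, 0 < lam n) {f : ℕ → Ω → ℝ}
    (hf : ∀ n, AEStronglyMeasurable (f n) P) {K : ENNReal} (hfK : ∀ n, eLpNorm (f n) q P ≤ K)
    (n : ℕ) :
    eLpNorm (fun ω => (∑ i ∈ Finset.range n, lam i)⁻¹ * ∑ i ∈ Finset.range n, lam i * f i ω) q P
      ≤ K := by
  set S := ∑ i ∈ Finset.range n, lam i with hS
  have hS0 : 0 ≤ S := Finset.sum_nonneg fun i _ => (hlam i).le
  have hrw : (fun ω => S⁻¹ * ∑ i ∈ Finset.range n, lam i * f i ω)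
      = S⁻¹ • ∑ i ∈ Finset.range n, lam i • f i := by
    ext ω
    simp
  rw [hrw, eLpNorm_const_smul]
  have hsum : eLpNorm (∑ i ∈ Finset.range n, lam i • f i) q P ≤ ENNReal.ofReal S * K := by
    refine (eLpNorm_sum_le (fun i _ => (hf i).const_smul (lam i)) hq).trans ?_
    rw [hS, ENNReal.ofReal_sum_of_nonneg fun i _ => (hlam i).le, Finset.sum_mul]
    refine Finset.sum_le_sum fun i _ => ?_
    rw [eLpNorm_const_smul, Real.enorm_eq_ofReal (hlam i).le]
    gcongr
    exact hfK i
  rw [Real.enorm_eq_ofReal (inv_nonneg.2 hS0)]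
  calc _ ≤ ENNReal.ofReal S⁻¹ * (ENNReal.ofReal S * K) := by gcongr
    _ = ENNReal.ofReal (S⁻¹ * S) * K := by
      rw [← mul_assoc, ENNReal.ofReal_mul (inv_nonneg.2 hS0)]
    _ ≤ 1 * K := by
      gcongr
      exact ENNReal.ofReal_le_one.2 (inv_mul_le_one_of_le₀ le_rfl hS0)
    _ = K := one_mul K

/-- A sequence with bounded absolute moments of order `q` is bounded in `L^q`, also after
subtraction of a constant. -/
theorem exists_eLpNorm_sub_const_le {Ω : Type*} [MeasurableSpace Ω] {P : Measure Ω}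
    [IsProbabilityMeasure P] {q : ℝ} (hq : 1 ≤ q) {X : ℕ → Ω → ℝ}
    (hX : ∀ n, MemLp (X n) (ENNReal.ofReal q) P) {M : ℝ}
    (hM : ∀ n, ∫ ω, |X n ω| ^ q ∂P ≤ M) (m : ℝ) :
    ∃ K : ENNReal, K ≠ ⊤ ∧
      ∀ n, eLpNorm (fun ω => X n ω - m) (ENNReal.ofReal q) P ≤ K := by
  have hq0 : 0 < q := by linarith
  refine ⟨ENNReal.ofReal (M ^ q⁻¹) + ENNReal.ofReal |m|, by simp, fun n => ?_⟩
  refine (eLpNorm_sub_le (hX n).1 (aestronglyMeasurable_const (b := m))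
    (by simpa using hq)).trans (add_le_add ?_ ?_)
  · rw [(hX n).eLpNorm_eq_integral_rpow_norm (by simpa using hq0) (by simp),
      ENNReal.toReal_ofReal hq0.le]
    refine ENNReal.ofReal_le_ofReal ?_
    refine Real.rpow_le_rpow (integral_nonneg fun ω => by positivity) (hM n) (by positivity)
  · refine (eLpNorm_le_of_ae_bound (C := |m|) ?_).trans (by simp)
    exact Eventually.of_forall fun ω => by simp

/-- The worst-case aggregate of a positively homogeneous subadditive functional over portfolios
with marginals in a class `D` is the total weight times the worst case over `D`. -/
theorem sSup_weighted_sum_eq {Ω : Type*} [MeasurableSpace Ω] {P : Measure Ω} {p : ENNReal}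
    {R : (Ω → ℝ) → ℝ}
    (hposhom : ∀ X : Ω → ℝ, MemLp X p P → ∀ c : ℝ, 0 < c → R (fun ω => c * X ω) = c * R X)
    (hsubadd : ∀ X Y : Ω → ℝ, MemLp X p P → MemLp Y p P →
      R (fun ω => X ω + Y ω) ≤ R X + R Y)
    {lam : ℕ → ℝ} (hlam : ∀ n, 0 < lam n) {D : (Ω → ℝ) → Prop} {Z : Ω → ℝ}
    (hZ : MemLp Z p P) (hZD : D Z)
    (hbdd : BddAbove {r : ℝ | ∃ Y : Ω → ℝ, MemLp Y p P ∧ D Y ∧ r = R Y})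
    {n : ℕ} (hn : 0 < n) :
    sSup {r : ℝ | ∃ Y : Fin n → Ω → ℝ, (∀ i, MemLp (Y i) p P) ∧ (∀ i, D (Y i)) ∧
        r = R (fun ω => ∑ i : Fin n, lam i.val * Y i ω)} =
      (∑ i ∈ Finset.range n, lam i) *
        sSup {r : ℝ | ∃ Y : Ω → ℝ, MemLp Y p P ∧ D Y ∧ r = R Y} := by
  have h0 : R (fun _ => 0) = 0 := by
    have := hposhom (fun _ => 0) MemLp.zero' 2 two_pos
    simp only [mul_zero] at this
    linarith
  have hS : 0 < ∑ i ∈ Finset.range n, lam i :=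
    Finset.sum_pos (fun i _ => hlam i) (Finset.nonempty_range_iff.2 hn.ne')
  have hmem : ∀ Y : Ω → ℝ, MemLp Y p P → D Y → (∑ i ∈ Finset.range n, lam i) * R Y ∈
      {r : ℝ | ∃ Y : Fin n → Ω → ℝ, (∀ i, MemLp (Y i) p P) ∧ (∀ i, D (Y i)) ∧
        r = R (fun ω => ∑ i : Fin n, lam i.val * Y i ω)} := fun Y hY hYD =>
    ⟨fun _ => Y, fun _ => hY, fun _ => hYD, by
      rw [← hposhom Y hY _ hS]
      simp_rw [← Finset.sum_mul, Fin.sum_univ_eq_sum_range (fun i => lam i) n]⟩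
  have hsum : ∀ (Y : Fin n → Ω → ℝ), (∀ i, MemLp (Y i) p P) → ∀ s : Finset (Fin n),
      R (fun ω => ∑ i ∈ s, lam i.val * Y i ω) ≤ ∑ i ∈ s, lam i.val * R (Y i) := by
    intro Y hY s
    induction s using Finset.induction_on with
    | empty => simp [h0]
    | insert a s ha ih =>
      simp_rw [Finset.sum_insert ha]
      refine (hsubadd _ _ ((hY a).const_mul _)
        (memLp_finsetSum s fun i _ => (hY i).const_mul _)).trans ?_
      rw [hposhom _ (hY a) _ (hlam a)]
      gcongr
  have hub : ∀ r ∈ {r : ℝ | ∃ Y : Fin n → Ω → ℝ, (∀ i, MemLp (Y i) p P) ∧ (∀ i, D (Y i)) ∧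
        r = R (fun ω => ∑ i : Fin n, lam i.val * Y i ω)},
      r ≤ (∑ i ∈ Finset.range n, lam i) *
        sSup {r : ℝ | ∃ Y : Ω → ℝ, MemLp Y p P ∧ D Y ∧ r = R Y} := by
    rintro r ⟨Y, hY, hYD, rfl⟩
    refine (hsum Y hY Finset.univ).trans ?_
    rw [← Fin.sum_univ_eq_sum_range (fun i => lam i) n, Finset.sum_mul]
    refine Finset.sum_le_sum fun i _ => ?_
    exact mul_le_mul_of_nonneg_left (le_csSup hbdd ⟨Y i, hY i, hYD i, rfl⟩) (hlam i).le
  refine le_antisymm (csSup_le ⟨_, hmem Z hZ hZD⟩ hub) ?_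
  rw [← le_div_iff₀' hS]
  refine csSup_le ⟨_, Z, hZ, hZD, rfl⟩ ?_
  rintro r ⟨Y, hY, hYD, rfl⟩
  rw [le_div_iff₀' hS]
  exact le_csSup ⟨_, hub⟩ (hmem Y hY hYD)

/-- Asymptotic ratio between the worst-case aggregate risk over
portfolios with marginals identically distributed as `Z` and the aggregate risk of a
diversified benchmark, for a coherent risk measure on `L^p(Ω)`. -/
theorem stmt_8
    {Ω : Type*} [MeasurableSpace Ω] (P : Measure Ω) [IsProbabilityMeasure P]
    (p q : ℝ) (hp : 1 ≤ p) (hpq : p < q)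
    (lam : ℕ → ℝ) (hlam : ∀ n, 0 < lam n)
    (Lp : (Ω → ℝ) → Prop)
    (hLpdef : ∀ X : Ω → ℝ,
      Lp X ↔ (AEMeasurable X P ∧ Integrable (fun ω => |X ω| ^ p) P))
    (R : (Ω → ℝ) → ℝ)
    (hmono : ∀ X Y : Ω → ℝ, Lp X → Lp Y → (∀ᵐ ω ∂P, X ω ≤ Y ω) → R X ≤ R Y)
    (hcash : ∀ X : Ω → ℝ, Lp X → ∀ c : ℝ, R (fun ω => X ω + c) = R X + c)
    (hposhom : ∀ X : Ω → ℝ, Lp X → ∀ c : ℝ, 0 < c → R (fun ω => c * X ω) = c * R X)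
    (hsubadd : ∀ X Y : Ω → ℝ, Lp X → Lp Y → R (fun ω => X ω + Y ω) ≤ R X + R Y)
    (X : ℕ → Ω → ℝ)
    (hX : ∀ n, Lp (X n))
    (hXint : ∀ n, Integrable (X n) P)
    (hXq : ∀ n, Integrable (fun ω => |X n ω| ^ q) P)
    (hXqbdd : ∃ M : ℝ, ∀ n, ∫ ω, |X n ω| ^ q ∂P ≤ M)
    (hXmean : ∀ n, ∫ ω, X n ω ∂P = ∫ ω, X 0 ω ∂P)
    (hXmeanpos : 0 < ∫ ω, X 0 ω ∂P)
    (hwlln : ∀ ε > (0:ℝ), Tendsto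
      (fun n => P {ω | ε < |(∑ i ∈ Finset.range n, lam i)⁻¹ *
          ∑ i ∈ Finset.range n, lam i * (X i ω - ∫ ω', X 0 ω' ∂P)|}) atTop (𝓝 0))
    (Z : Ω → ℝ) (hZ : Lp Z) :
    BddAbove {r : ℝ | ∃ Y : Ω → ℝ, Lp Y ∧
        Measure.map Y P = Measure.map Z P ∧ r = R Y} ∧
    Tendsto (fun n =>
        sSup {r : ℝ | ∃ Y : Fin n → Ω → ℝ, (∀ i, Lp (Y i)) ∧
            (∀ i, Measure.map (Y i) P = Measure.map Z P) ∧
            r = R (fun ω => ∑ i : Fin n, lam i.val * Y i ω)} /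
        R (fun ω => ∑ i ∈ Finset.range n, lam i * X i ω)) atTop
      (𝓝 (sSup {r : ℝ | ∃ Y : Ω → ℝ, Lp Y ∧
          Measure.map Y P = Measure.map Z P ∧ r = R Y} / ∫ ω, X 0 ω ∂P)) := by
  have hp0 : 0 < p := by linarith
  have : Fact (1 ≤ ENNReal.ofReal p) := ⟨by simpa using hp⟩
  have hmemLp : ∀ (s : ℝ), 0 < s → ∀ Y : Ω → ℝ, AEMeasurable Y P →
      (Integrable (fun ω => |Y ω| ^ s) P ↔ MemLp Y (ENNReal.ofReal s) P) := fun s hs Y hY => by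
    rw [← integrable_norm_rpow_iff hY.aestronglyMeasurable (by simpa using hs) (by simp),
      ENNReal.toReal_ofReal hs.le]
    simp only [Real.norm_eq_abs]
  obtain rfl : Lp = fun Y => MemLp Y (ENNReal.ofReal p) P := by
    funext Y
    rw [hLpdef]
    exact propext ⟨fun h => (hmemLp p hp0 Y h.1).1 h.2,
      fun h => ⟨h.1.aemeasurable, (hmemLp p hp0 Y h.1.aemeasurable).2 h⟩⟩
  beta_reduce at *
  obtain ⟨C, hC⟩ := exists_le_mul_eLpNorm_of_monotone hmono hposhom
  have hbdd : BddAbove {r : ℝ | ∃ Y : Ω → ℝ, MemLp Y (ENNReal.ofReal p) P ∧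
      Measure.map Y P = Measure.map Z P ∧ r = R Y} := by
    refine ⟨C * (eLpNorm Z (ENNReal.ofReal p) P).toReal, ?_⟩
    rintro r ⟨Y, hY, hYZ, rfl⟩
    have hid : ProbabilityTheory.IdentDistrib Y Z P P := ⟨hY.1.aemeasurable, hZ.1.aemeasurable, hYZ⟩
    rw [← hid.eLpNorm_eq]
    exact hC Y hY
  refine ⟨hbdd, ?_⟩
  set m := ∫ ω, X 0 ω ∂P with hm
  set A : ℕ → Ω → ℝ := fun n ω => (∑ i ∈ Finset.range n, lam i)⁻¹ *
    ∑ i ∈ Finset.range n, lam i * (X i ω - m) with hA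
  have hALp : ∀ n, MemLp (A n) (ENNReal.ofReal p) P := fun n =>
    (memLp_finsetSum _ fun i _ => ((hX i).sub (memLp_const m)).const_mul _).const_mul _
  have hAlim : Tendsto (fun n => (eLpNorm (A n) (ENNReal.ofReal p) P).toReal) atTop (𝓝 0) := by
    obtain ⟨M, hM⟩ := hXqbdd
    obtain ⟨K, hK, hXK⟩ := exists_eLpNorm_sub_const_le (q := q) (by linarith)
      (fun n => (hmemLp q (by linarith) (X n) (hX n).1.aemeasurable).1 (hXq n)) hM m
    have hAK : ∀ n, eLpNorm (A n) (ENNReal.ofReal q) P ≤ K :=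
      eLpNorm_weighted_average_le (by simpa using hp.trans hpq.le) hlam
        (fun n => ((hX n).sub (memLp_const m)).1) hXK
    have := tendsto_eLpNorm_zero_of_eLpNorm_le hp hpq (fun n => (hALp n).1) hK hAK hwlln
    simpa [Function.comp_def] using (ENNReal.tendsto_toReal ENNReal.zero_ne_top).comp this
  have hRA : Tendsto (fun n => R (A n)) atTop (𝓝 0) := by
    have hlim : Tendsto (fun n => C * (eLpNorm (A n) (ENNReal.ofReal p) P).toReal) atTop (𝓝 0) := by
      simpa using hAlim.const_mul C
    have h0 : R (fun _ => 0) = 0 := by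
      have := hposhom (fun _ => 0) MemLp.zero' 2 two_pos
      simp only [mul_zero] at this
      linarith
    refine tendsto_of_tendsto_of_tendsto_of_le_of_le (by simpa using hlim.neg) hlim
      (fun n => ?_) (fun n => hC _ (hALp n))
    have h1 := hsubadd (A n) (-A n) (hALp n) (hALp n).neg
    have h2 := hC (-A n) (hALp n).neg
    rw [eLpNorm_neg] at h2
    simp only [Pi.neg_apply, add_neg_cancel, h0] at h1
    beta_reduce
    linarith
  have hlim : Tendsto (fun n => sSup {r : ℝ | ∃ Y : Ω → ℝ, MemLp Y (ENNReal.ofReal p) P ∧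
      Measure.map Y P = Measure.map Z P ∧ r = R Y} / (R (A n) + m)) atTop
      (𝓝 (sSup {r : ℝ | ∃ Y : Ω → ℝ, MemLp Y (ENNReal.ofReal p) P ∧
      Measure.map Y P = Measure.map Z P ∧ r = R Y} / m)) := by
    refine tendsto_const_nhds.div ?_ hXmeanpos.ne'
    simpa using hRA.add_const m
  refine hlim.congr' ?_
  filter_upwards [eventually_gt_atTop 0] with n hn
  have hS : 0 < ∑ i ∈ Finset.range n, lam i :=
    Finset.sum_pos (fun i _ => hlam i) (Finset.nonempty_range_iff.2 hn.ne')
  have hden : R (fun ω => ∑ i ∈ Finset.range n, lam i * X i ω) =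
      (∑ i ∈ Finset.range n, lam i) * (R (A n) + m) := by
    rw [← hcash _ (hALp n), ← hposhom (fun ω => A n ω + m) ((hALp n).add (memLp_const m)) _ hS]
    congr 1
    ext ω
    simp only [hA, mul_sub, Finset.sum_sub_distrib, ← Finset.sum_mul]
    field_simp
    ring
  rw [sSup_weighted_sum_eq (D := fun Y => Measure.map Y P = Measure.map Z P) hposhom hsubadd hlam
    hZ rfl hbdd hn, hden, mul_div_mul_left _ _ hS.ne']
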